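/- Let R ⊆ α × β, S ⊆ β × γ, T ⊆ γ × δ be finite relations and let J3 = {(x,y,z,u) : (x,y) ∈ R, (y,z) ∈ S, (z,u) ∈ T}. Then |J3| ≤ (Σ_{y ∈ β} |{x : (x,y) ∈ R}|²)^{1/2} · |S|^{1/2} · (Σ_{z ∈ γ} |{u : (z,u) ∈ T}|²)^{1/2}. (The q-inequality |J3| ≤ ‖deg_R(X|Y)‖_2 · |S|^{1/2} · ‖deg_T(U|Z)‖_2.) -/

import Mathlib

/-- The q-inequality `|J3| ≤ ‖deg_R(X|Y)‖_2 · |S|^{1/2} · ‖deg_T(U|Z)‖_2`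
for the three-way join. -/
theorem three_way_join_l2_bound {α β γ δ : Type*}
    [Fintype α] [Fintype β] [Fintype γ] [Fintype δ]
    [DecidableEq α] [DecidableEq β] [DecidableEq γ] [DecidableEq δ]
    (R : Finset (α × β)) (S : Finset (β × γ)) (T : Finset (γ × δ)) :
    ((Finset.univ.filter
        (fun t : α × β × γ × δ =>
          (t.1, t.2.1) ∈ R ∧ (t.2.1, t.2.2.1) ∈ S ∧ (t.2.2.1, t.2.2.2) ∈ T)).card : ℝ)
    ≤ (∑ y, ((R.filter (fun t => t.2 = y)).card : ℝ) ^ 2) ^ ((1 : ℝ) / 2)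
      * (S.card : ℝ) ^ ((1 : ℝ) / 2)
      * (∑ z, ((T.filter (fun t => t.1 = z)).card : ℝ) ^ 2) ^ ((1 : ℝ) / 2) := by
  classical
  set J := (Finset.univ.filter
        (fun t : α × β × γ × δ =>
          (t.1, t.2.1) ∈ R ∧ (t.2.1, t.2.2.1) ∈ S ∧ (t.2.2.1, t.2.2.2) ∈ T)) with hJ
  set a : β → ℝ := fun y => ((R.filter (fun t => t.2 = y)).card : ℝ) with ha
  set b : γ → ℝ := fun z => ((T.filter (fun t => t.1 = z)).card : ℝ) with hb
  have h1 : (J.card : ℝ) ≤ ∑ p ∈ S, a p.1 * b p.2 := by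
    have hm : ∀ t ∈ J, (t.2.1, t.2.2.1) ∈ S := by
      intro t ht
      exact ((Finset.mem_filter.mp ht).2).2.1
    rw [Finset.card_eq_sum_card_fiberwise (s := J)
      (f := fun t : α × β × γ × δ => (t.2.1, t.2.2.1)) (t := S) hm]
    push_cast
    refine Finset.sum_le_sum fun p _ => ?_
    simp only [ha, hb]
    rw [← Nat.cast_mul, ← Finset.card_product]
    norm_cast
    refine Finset.card_le_card_of_injOn
      (fun t => ((t.1, t.2.1), (t.2.2.1, t.2.2.2))) ?_ ?_
    · rintro ⟨x, y, z, u⟩ ht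
      obtain ⟨p1, p2⟩ := p
      simp [hJ] at ht ⊢
      tauto
    · rintro ⟨x, y, z, u⟩ _ ⟨x', y', z', u'⟩ _ h
      simp at h ⊢
      tauto
  have h2 : (∑ p ∈ S, a p.1 * b p.2) ^ 2 ≤ (S.card : ℝ) * ∑ p ∈ S, (a p.1 * b p.2) ^ 2 :=
    sq_sum_le_card_mul_sum_sq
  have h3 : ∑ p ∈ S, (a p.1 * b p.2) ^ 2 ≤ (∑ y, a y ^ 2) * ∑ z, b z ^ 2 := by
    rw [Finset.sum_mul_sum, ← Fintype.sum_prod_type' (fun y z => a y ^ 2 * b z ^ 2)]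
    simp only [mul_pow]
    exact Finset.sum_le_sum_of_subset_of_nonneg (Finset.subset_univ _)
      (fun _ _ _ => mul_nonneg (sq_nonneg _) (sq_nonneg _))
  have hA : 0 ≤ ∑ y, a y ^ 2 := Finset.sum_nonneg fun _ _ => sq_nonneg _
  change (J.card : ℝ) ≤ (∑ y, a y ^ 2) ^ ((1 : ℝ) / 2) * (S.card : ℝ) ^ ((1 : ℝ) / 2)
    * (∑ z, b z ^ 2) ^ ((1 : ℝ) / 2)
  simp only [← Real.sqrt_eq_rpow]
  rw [← Real.sqrt_mul hA, ← Real.sqrt_mul (mul_nonneg hA (Nat.cast_nonneg _))]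
  refine h1.trans (Real.le_sqrt_of_sq_le (h2.trans ?_))
  calc (S.card : ℝ) * ∑ p ∈ S, (a p.1 * b p.2) ^ 2
      ≤ (S.card : ℝ) * ((∑ y, a y ^ 2) * ∑ z, b z ^ 2) :=
        mul_le_mul_of_nonneg_left h3 (Nat.cast_nonneg _)
    _ = _ := by ring
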